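/- Let n ≥ 2 and k = 2^n. For ℓ ∈ {0,…,k−1} let Δ_ℓ be the convex hull of w_{ℓ−1}, v_ℓ, and w_ℓ (indices mod k). Then each Δ_ℓ is contained in Q_k, and for all ℓ ≠ ℓ′ the interiors of Δ_ℓ and Δ_{ℓ′} are disjoint. -/

import Mathlib

open Real MeasureTheory Matrix

/-- The clockwise rotation matrix by angle `π / 2 ^ j` (this is `R_{j+1}` in 1-based indexing). -/
noncomputable def rotM (j : ℕ) : Matrix (Fin 2) (Fin 2) ℝ :=
  !![Real.cos (Real.pi / 2 ^ j), Real.sin (Real.pi / 2 ^ j);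
     -Real.sin (Real.pi / 2 ^ j), Real.cos (Real.pi / 2 ^ j)]

/-- The reflection with respect to the first axis. -/
def reflM : Matrix (Fin 2) (Fin 2) ℝ := !![1, 0; 0, -1]

/-- The vertex `v_ℓ = sec(π/2^n) (cos((2ℓ+1)π/2^n), sin((2ℓ+1)π/2^n))` of the regular `2^n`-gon. -/
noncomputable def vtx (n ℓ : ℕ) : Fin 2 → ℝ :=
  (Real.cos (Real.pi / 2 ^ n))⁻¹ •
    ![Real.cos ((2 * ℓ + 1) * Real.pi / 2 ^ n), Real.sin ((2 * ℓ + 1) * Real.pi / 2 ^ n)]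

/-- The facet midpoint `w_ℓ = (cos((2ℓ+2)π/2^n), sin((2ℓ+2)π/2^n))`. -/
noncomputable def wpt (n ℓ : ℕ) : Fin 2 → ℝ :=
  ![Real.cos ((2 * ℓ + 2) * Real.pi / 2 ^ n), Real.sin ((2 * ℓ + 2) * Real.pi / 2 ^ n)]

/-- `chainAux n b x i = R^{b_i} R_i ⋯ R^{b_1} R_1 x` (1-based indexing of `b` and `R`). -/
noncomputable def chainAux (n : ℕ) (b : Fin n → Fin 2) (x : Fin 2 → ℝ) : ℕ → Fin 2 → ℝ
  | 0 => x
  | i + 1 =>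
    if h : i < n then
      (reflM ^ ((b ⟨i, h⟩ : Fin 2) : ℕ)) *ᵥ (rotM i *ᵥ chainAux n b x i)
    else chainAux n b x i
/-- The polyhedron `P^∅_n` in the space of pairs `(y, z)` (0-based: `y i` is `y_{i+1}`). -/
def Pempty (n : ℕ) : Set ((Fin (n + 1) → ℝ) × (Fin (n + 1) → ℝ)) :=
  {p | (∀ i : Fin n,
        p.1 i.succ = Real.cos (Real.pi / 2 ^ (i : ℕ)) * p.1 i.castSucc
            + Real.sin (Real.pi / 2 ^ (i : ℕ)) * p.2 i.castSucc ∧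
        p.2 i.succ ≥ -Real.sin (Real.pi / 2 ^ (i : ℕ)) * p.1 i.castSucc
            + Real.cos (Real.pi / 2 ^ (i : ℕ)) * p.2 i.castSucc ∧
        p.2 i.succ ≥ Real.sin (Real.pi / 2 ^ (i : ℕ)) * p.1 i.castSucc
            - Real.cos (Real.pi / 2 ^ (i : ℕ)) * p.2 i.castSucc) ∧
    p.1 (Fin.last n) ≤ 1 ∧
    Real.cos (Real.pi / 2 ^ (n - 1)) * p.1 (Fin.last n)
        + Real.sin (Real.pi / 2 ^ (n - 1)) * p.2 (Fin.last n) ≤ 1}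

/-- The polyhedron `P^e_n` for an edge `e` (0-based indexing of `{1,…,n}` as `Fin n`). -/
def Pe (n : ℕ) (e : Finset (Fin n)) : Set ((Fin (n + 1) → ℝ) × (Fin (n + 1) → ℝ)) :=
  {p | (∀ i : Fin n,
        p.1 i.succ = Real.cos (Real.pi / 2 ^ (i : ℕ)) * p.1 i.castSucc
            + Real.sin (Real.pi / 2 ^ (i : ℕ)) * p.2 i.castSucc ∧
        (if i ∈ e then
          p.2 i.succ = -Real.sin (Real.pi / 2 ^ (i : ℕ)) * p.1 i.castSucc
              + Real.cos (Real.pi / 2 ^ (i : ℕ)) * p.2 i.castSucc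
        else
          p.2 i.succ ≥ -Real.sin (Real.pi / 2 ^ (i : ℕ)) * p.1 i.castSucc
              + Real.cos (Real.pi / 2 ^ (i : ℕ)) * p.2 i.castSucc ∧
          p.2 i.succ ≥ Real.sin (Real.pi / 2 ^ (i : ℕ)) * p.1 i.castSucc
              - Real.cos (Real.pi / 2 ^ (i : ℕ)) * p.2 i.castSucc)) ∧
    Real.cos (Real.pi / 2 ^ n) * p.1 (Fin.last n)
        + Real.sin (Real.pi / 2 ^ n) * p.2 (Fin.last n) ≤ Real.cos (Real.pi / 2 ^ n)}

/-- Projection of a pair `(y, z)` to the coordinates `(y_1, z_1)`. -/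
def proj2 {n : ℕ} (p : (Fin (n + 1) → ℝ) × (Fin (n + 1) → ℝ)) : Fin 2 → ℝ :=
  ![p.1 0, p.2 0]

/-- The regular `2^n`-gon `Q_{2^n}`, as the convex hull of its vertices. -/
def Qgon (n : ℕ) : Set (Fin 2 → ℝ) :=
  convexHull ℝ {x | ∃ ℓ < 2 ^ n, x = vtx n ℓ}

/-- The triangle `Δ_ℓ` spanned by `w_{ℓ-1}`, `v_ℓ` and `w_ℓ` (indices mod `2^n`). -/
def tri (n ℓ : ℕ) : Set (Fin 2 → ℝ) :=
  convexHull ℝ {wpt n (ℓ + 2 ^ n - 1), vtx n ℓ, wpt n ℓ}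


lemma cos_pi_div_two_pow_pos {n : ℕ} (hn : 2 ≤ n) : 0 < Real.cos (Real.pi / 2 ^ n) := by
  have h4 : (2 : ℝ) ^ 2 ≤ 2 ^ n := pow_le_pow_right₀ (by norm_num) hn
  apply Real.cos_pos_of_mem_Ioo
  constructor
  · have : 0 < Real.pi / 2 ^ n := by positivity
    linarith [Real.pi_pos]
  · rw [div_lt_div_iff₀ (by positivity) (by norm_num)]
    nlinarith [Real.pi_pos]

lemma vtx_add_period (n ℓ : ℕ) : vtx n (ℓ + 2 ^ n) = vtx n ℓ := by
  have h : (2 * ((ℓ + 2 ^ n : ℕ) : ℝ) + 1) * Real.pi / 2 ^ n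
      = (2 * ℓ + 1) * Real.pi / 2 ^ n + 2 * Real.pi := by
    push_cast
    field_simp
    ring
  simp only [vtx, h, Real.cos_add_two_pi, Real.sin_add_two_pi]

lemma wpt_pred_add_period (n ℓ : ℕ) :
    wpt n (ℓ + 2 ^ n - 1) =
      ![Real.cos (2 * ℓ * Real.pi / 2 ^ n), Real.sin (2 * ℓ * Real.pi / 2 ^ n)] := by
  have h : (2 * ((ℓ + 2 ^ n - 1 : ℕ) : ℝ) + 2) * Real.pi / 2 ^ n
      = 2 * ℓ * Real.pi / 2 ^ n + 2 * Real.pi := by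
    rw [Nat.cast_sub (le_add_left Nat.one_le_two_pow)]
    push_cast
    field_simp
    ring
  simp only [wpt, h, Real.cos_add_two_pi, Real.sin_add_two_pi]

lemma wpt_eq_midpoint {n : ℕ} (hn : 2 ≤ n) (ℓ : ℕ) :
    wpt n ℓ = midpoint ℝ (vtx n ℓ) (vtx n (ℓ + 1)) := by
  have hc := (cos_pi_div_two_pow_pos hn).ne'
  have h₁ : (2 * (ℓ : ℝ) + 1) * Real.pi / 2 ^ n
      = (2 * ℓ + 2) * Real.pi / 2 ^ n - Real.pi / 2 ^ n := by ring
  have h₂ : (2 * ((ℓ + 1 : ℕ) : ℝ) + 1) * Real.pi / 2 ^ n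
      = (2 * ℓ + 2) * Real.pi / 2 ^ n + Real.pi / 2 ^ n := by push_cast; ring
  rw [midpoint_eq_smul_add]
  simp only [vtx, wpt, h₁, h₂, Real.cos_add, Real.cos_sub, Real.sin_add, Real.sin_sub]
  ext i
  fin_cases i <;> simp <;> field_simp <;> ring

lemma vtx_mem_Qgon (n ℓ : ℕ) : vtx n ℓ ∈ Qgon n := by
  have hper : Function.Periodic (vtx n) (2 ^ n) := vtx_add_period n
  exact subset_convexHull ℝ _
    ⟨ℓ % 2 ^ n, Nat.mod_lt _ (by positivity), (hper.map_mod_nat ℓ).symm⟩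

lemma wpt_mem_Qgon {n : ℕ} (hn : 2 ≤ n) (ℓ : ℕ) : wpt n ℓ ∈ Qgon n := by
  rw [wpt_eq_midpoint hn]
  exact (convex_convexHull ℝ _).midpoint_mem (vtx_mem_Qgon n ℓ) (vtx_mem_Qgon n (ℓ + 1))

lemma tri_subset_Qgon {n : ℕ} (hn : 2 ≤ n) (ℓ : ℕ) : tri n ℓ ⊆ Qgon n := by
  refine convexHull_min ?_ (convex_convexHull ℝ _)
  rintro x (rfl | rfl | rfl)
  exacts [wpt_mem_Qgon hn _, vtx_mem_Qgon n ℓ, wpt_mem_Qgon hn ℓ]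

/-- The cross product of the unit vector at angle `c` with a vector of the plane. -/
noncomputable def crossUnit (c : ℝ) : (Fin 2 → ℝ) →ₗ[ℝ] ℝ :=
  Real.cos c • LinearMap.proj 1 - Real.sin c • LinearMap.proj 0

lemma crossUnit_polar (c θ : ℝ) :
    crossUnit c ![Real.cos θ, Real.sin θ] = Real.sin (θ - c) := by
  simp [crossUnit, Real.sin_sub]
  ring

/-- Two subsets of the plane weakly separated by a line through the origin have disjoint
interiors. -/
lemma interior_inter_interior_eq_empty_of_crossUnit {A B : Set (Fin 2 → ℝ)} (c : ℝ)
    (hA : ∀ x ∈ A, crossUnit c x ≤ 0) (hB : ∀ x ∈ B, 0 ≤ crossUnit c x) :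
    interior A ∩ interior B = ∅ := by
  rw [← interior_inter, ← Set.not_nonempty_iff_eq_empty]
  intro h
  have hsub : A ∩ B ⊆ (LinearMap.ker (crossUnit c) : Set (Fin 2 → ℝ)) :=
    fun x hx => le_antisymm (hA x hx.1) (hB x hx.2)
  have htop := Submodule.eq_top_of_nonempty_interior' _ (h.mono (interior_mono hsub))
  have hzero : crossUnit c ![Real.cos (c + Real.pi / 2), Real.sin (c + Real.pi / 2)] = 0 := by
    rw [LinearMap.ker_eq_top.mp htop, LinearMap.zero_apply]
  rw [crossUnit_polar] at hzero
  simp at hzero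

lemma forall_mem_tri_of_forall_polar {n : ℕ} (hn : 2 ≤ n) {ℓ : ℕ} {f : (Fin 2 → ℝ) →ₗ[ℝ] ℝ}
    (hf : ∀ t ∈ Set.Icc (2 * ℓ : ℝ) (2 * ℓ + 2),
      0 ≤ f ![Real.cos (t * Real.pi / 2 ^ n), Real.sin (t * Real.pi / 2 ^ n)]) :
    ∀ x ∈ tri n ℓ, 0 ≤ f x := by
  change tri n ℓ ⊆ {x | 0 ≤ f x}
  refine convexHull_min ?_ (convex_halfSpace_ge f.isLinear 0)
  rintro x (rfl | rfl | rfl)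
  · rw [wpt_pred_add_period]
    exact hf _ ⟨le_rfl, by linarith⟩
  · rw [Set.mem_ofPred_eq, vtx, map_smul]
    exact smul_nonneg (inv_nonneg.mpr (cos_pi_div_two_pow_pos hn).le)
      (hf _ ⟨by linarith, by linarith⟩)
  · exact hf _ ⟨by linarith, le_rfl⟩

lemma interior_tri_inter_interior_tri_of_lt {n : ℕ} (hn : 2 ≤ n) {ℓ ℓ' : ℕ} (hlt : ℓ < ℓ')
    (hℓ' : ℓ' < 2 ^ n) : interior (tri n ℓ) ∩ interior (tri n ℓ') = ∅ := by
  have h₁ : (ℓ : ℝ) + 1 ≤ ℓ' := by exact_mod_cast hlt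
  have h₂ : (ℓ' : ℝ) + 1 ≤ 2 ^ n := by exact_mod_cast hℓ'
  have h₃ : (0 : ℝ) ≤ ℓ := ℓ.cast_nonneg
  have hsin : ∀ s : ℝ, 0 ≤ s → s ≤ 2 ^ n → 0 ≤ Real.sin (s * Real.pi / 2 ^ n) := by
    intro s hs₀ hs₁
    apply Real.sin_nonneg_of_nonneg_of_le_pi (by positivity)
    rw [div_le_iff₀ (by positivity)]
    nlinarith [Real.pi_pos]
  -- The separating line bisects the angle between the axes of the two triangles.
  apply interior_inter_interior_eq_empty_of_crossUnit ((ℓ + ℓ' + 1) * Real.pi / 2 ^ n)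
  · intro x hx
    rw [← neg_nonneg, ← LinearMap.neg_apply]
    refine forall_mem_tri_of_forall_polar hn (fun t ht => ?_) x hx
    rw [LinearMap.neg_apply, crossUnit_polar, ← Real.sin_neg]
    convert hsin (ℓ + ℓ' + 1 - t) (by linarith [ht.2]) (by linarith [ht.1]) using 2
    ring
  · refine forall_mem_tri_of_forall_polar hn fun t ht => ?_
    rw [crossUnit_polar]
    convert hsin (t - (ℓ + ℓ' + 1)) (by linarith [ht.1]) (by linarith [ht.2]) using 2
    ring

/-- Each triangle `Δ_ℓ` is contained in `Q_{2^n}`, and the interiors of distinct triangles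
`Δ_ℓ`, `Δ_{ℓ′}` are disjoint. -/
theorem tri_subset_and_interiors_disjoint (n : ℕ) (hn : 2 ≤ n) :
    (∀ ℓ < 2 ^ n, tri n ℓ ⊆ Qgon n) ∧
    ∀ ℓ < 2 ^ n, ∀ ℓ' < 2 ^ n, ℓ ≠ ℓ' →
      interior (tri n ℓ) ∩ interior (tri n ℓ') = ∅ := by
  refine ⟨fun ℓ _ => tri_subset_Qgon hn ℓ, fun ℓ hℓ ℓ' hℓ' hne => ?_⟩
  rcases hne.lt_or_gt with hlt | hlt
  · exact interior_tri_inter_interior_tri_of_lt hn hlt hℓ'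
  · rw [Set.inter_comm]
    exact interior_tri_inter_interior_tri_of_lt hn hlt hℓ
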